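/- Assume ∫ (p̃0 + p̃1)(1 + U′(x)^2) dμ < ∞ and that D1 = D_KL(P1‖P0) and D0 = D_KL(P0‖P1) are finite. Let m(β) = E_{X∼P_β}[U′(X)] and v(β) = Var_{X∼P_β}[U′(X)], and let U′(X) denote the estimator obtained by drawing β uniformly from [0,1] and then X from P_β. Then by the law of total variance, Var[U′(X)] = ∫_0^1 v(β) dβ + ∫_0^1 m(β)^2 dβ − (∫_0^1 m(β) dβ)^2, and this is bounded above by D1 + D0 + 2|log(Z1/Z0)| + ∫_0^1 m(β)^2 dβ − log^2(Z1/Z0). -/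

import Mathlib

open MeasureTheory ProbabilityTheory
open scoped ENNReal

/-- The partition function `Z_β = ∫ p̃₁^β p̃₀^{1-β} dμ` along the geometric path. -/
noncomputable def pathZ {𝒳 : Type*} [MeasurableSpace 𝒳] (μ : Measure 𝒳)
    (p₀ p₁ : 𝒳 → ℝ) (β : ℝ) : ℝ :=
  ∫ x, p₁ x ^ β * p₀ x ^ (1 - β) ∂μ

/-- The mean `m(β) = E_{X ∼ P_β}[U′(X)]` of `U′ = log (p̃₁/p̃₀)` under `P_β`. -/
noncomputable def pathMean {𝒳 : Type*} [MeasurableSpace 𝒳] (μ : Measure 𝒳)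
    (p₀ p₁ : 𝒳 → ℝ) (β : ℝ) : ℝ :=
  ∫ x, (p₁ x ^ β * p₀ x ^ (1 - β) / pathZ μ p₀ p₁ β) * Real.log (p₁ x / p₀ x) ∂μ

/-- The variance `v(β) = Var_{X ∼ P_β}[U′(X)]`. -/
noncomputable def pathVar {𝒳 : Type*} [MeasurableSpace 𝒳] (μ : Measure 𝒳)
    (p₀ p₁ : 𝒳 → ℝ) (β : ℝ) : ℝ :=
  (∫ x, (p₁ x ^ β * p₀ x ^ (1 - β) / pathZ μ p₀ p₁ β) * Real.log (p₁ x / p₀ x) ^ 2 ∂μ)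
    - pathMean μ p₀ p₁ β ^ 2

/-- The law of the thermodynamic-integration sample: `β ∼ Uniform([0,1])`, `X | β ∼ P_β`. -/
noncomputable def tiLaw {𝒳 : Type*} [MeasurableSpace 𝒳] (μ : Measure 𝒳)
    (p₀ p₁ : 𝒳 → ℝ) : Measure 𝒳 :=
  ((volume : Measure ℝ).restrict (Set.Icc 0 1)).bind
    (fun β => μ.withDensity
      (fun x => ENNReal.ofReal (p₁ x ^ β * p₀ x ^ (1 - β) / pathZ μ p₀ p₁ β)))

/-- The weighted geometric mean of two positive reals is at most their sum. -/
theorem rpow_mul_rpow_one_sub_le_add {a b β : ℝ} (ha : 0 < a) (hb : 0 < b)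
    (hβ : β ∈ Set.Icc (0 : ℝ) 1) : b ^ β * a ^ (1 - β) ≤ a + b := by
  have h := Real.geom_mean_le_arith_mean2_weighted hβ.1 (sub_nonneg.2 hβ.2) hb.le ha.le (by ring)
  nlinarith [hβ.1, hβ.2]

theorem hasDerivAt_rpow_mul_rpow_one_sub {a b : ℝ} (ha : 0 < a) (hb : 0 < b) (β : ℝ) :
    HasDerivAt (fun t => b ^ t * a ^ (1 - t)) (b ^ β * a ^ (1 - β) * Real.log (b / a)) β := by
  have h₁ := (hasDerivAt_id β).const_rpow hb
  have h₂ := ((hasDerivAt_id β).const_sub 1).const_rpow ha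
  refine (h₁.mul h₂).congr_deriv ?_
  rw [Real.log_div hb.ne' ha.ne']
  simp only [id]
  ring

theorem norm_rpow_mul_rpow_one_sub_mul_le {a b β : ℝ} (ha : 0 < a) (hb : 0 < b)
    (hβ : β ∈ Set.Icc (0 : ℝ) 1) (c : ℝ) :
    ‖b ^ β * a ^ (1 - β) * c‖ ≤ (a + b) * |c| := by
  rw [norm_mul, Real.norm_of_nonneg (by positivity), Real.norm_eq_abs]
  gcongr
  exact rpow_mul_rpow_one_sub_le_add ha hb hβ

section GeometricPath

variable {𝒳 : Type*} [MeasurableSpace 𝒳] {μ : Measure 𝒳} {p₀ p₁ g : 𝒳 → ℝ} {β : ℝ}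

theorem measurable_path (hp₀ : Measurable p₀) (hp₁ : Measurable p₁) (β : ℝ) :
    Measurable fun x => p₁ x ^ β * p₀ x ^ (1 - β) :=
  (hp₁.pow_const _).mul (hp₀.pow_const _)

theorem integrable_path_mul (hp₀ : Measurable p₀) (hp₁ : Measurable p₁)
    (hp₀pos : ∀ x, 0 < p₀ x) (hp₁pos : ∀ x, 0 < p₁ x) (hg : Measurable g)
    (hgint : Integrable (fun x => (p₀ x + p₁ x) * |g x|) μ) (hβ : β ∈ Set.Icc (0 : ℝ) 1) :
    Integrable (fun x => p₁ x ^ β * p₀ x ^ (1 - β) * g x) μ :=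
  hgint.mono' ((measurable_path hp₀ hp₁ β).mul hg).aestronglyMeasurable
    (.of_forall fun x => norm_rpow_mul_rpow_one_sub_mul_le (hp₀pos x) (hp₁pos x) hβ (g x))

theorem continuousOn_integral_path_mul (hp₀ : Measurable p₀) (hp₁ : Measurable p₁)
    (hp₀pos : ∀ x, 0 < p₀ x) (hp₁pos : ∀ x, 0 < p₁ x) (hg : Measurable g)
    (hgint : Integrable (fun x => (p₀ x + p₁ x) * |g x|) μ) :
    ContinuousOn (fun β : ℝ => ∫ x, p₁ x ^ β * p₀ x ^ (1 - β) * g x ∂μ) (Set.Icc 0 1) :=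
  continuousOn_of_dominated
    (fun β _ => ((measurable_path hp₀ hp₁ β).mul hg).aestronglyMeasurable)
    (fun _ hβ => .of_forall fun x =>
      norm_rpow_mul_rpow_one_sub_mul_le (hp₀pos x) (hp₁pos x) hβ (g x)) hgint
    (.of_forall fun x β _ => ((hasDerivAt_rpow_mul_rpow_one_sub (hp₀pos x) (hp₁pos x) β).mul_const
      (g x)).continuousAt.continuousWithinAt)

theorem hasDerivAt_integral_path_mul (hp₀ : Measurable p₀) (hp₁ : Measurable p₁)
    (hp₀pos : ∀ x, 0 < p₀ x) (hp₁pos : ∀ x, 0 < p₁ x) (hg : Measurable g)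
    (hgint : Integrable (fun x => (p₀ x + p₁ x) * |g x|) μ)
    (hgint' : Integrable (fun x => (p₀ x + p₁ x) * |Real.log (p₁ x / p₀ x) * g x|) μ)
    (hβ : β ∈ Set.Ioo (0 : ℝ) 1) :
    HasDerivAt (fun t : ℝ => ∫ x, p₁ x ^ t * p₀ x ^ (1 - t) * g x ∂μ)
      (∫ x, p₁ x ^ β * p₀ x ^ (1 - β) * (Real.log (p₁ x / p₀ x) * g x) ∂μ) β := by
  refine (hasDerivAt_integral_of_dominated_loc_of_deriv_le
    (F' := fun t x => p₁ x ^ t * p₀ x ^ (1 - t) * (Real.log (p₁ x / p₀ x) * g x))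
    (Icc_mem_nhds hβ.1 hβ.2)
    (.of_forall fun t => ((measurable_path hp₀ hp₁ t).mul hg).aestronglyMeasurable)
    (integrable_path_mul hp₀ hp₁ hp₀pos hp₁pos hg hgint (Set.Ioo_subset_Icc_self hβ))
    ((measurable_path hp₀ hp₁ β).mul ((hp₁.div hp₀).log.mul hg)).aestronglyMeasurable
    (.of_forall fun x t ht => norm_rpow_mul_rpow_one_sub_mul_le (hp₀pos x) (hp₁pos x) ht _)
    hgint' (.of_forall fun x t _ => ?_)).2
  exact ((hasDerivAt_rpow_mul_rpow_one_sub (hp₀pos x) (hp₁pos x) t).mul_const (g x)).congr_deriv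
    (by ring)

theorem pathZ_pos (hp₀ : Measurable p₀) (hp₁ : Measurable p₁)
    (hp₀pos : ∀ x, 0 < p₀ x) (hp₁pos : ∀ x, 0 < p₁ x)
    (hint : Integrable (fun x => p₀ x + p₁ x) μ) (hμ : μ ≠ 0) (hβ : β ∈ Set.Icc (0 : ℝ) 1) :
    0 < pathZ μ p₀ p₁ β := by
  have hpos : ∀ x, 0 < p₁ x ^ β * p₀ x ^ (1 - β) := fun x =>
    mul_pos (Real.rpow_pos_of_pos (hp₁pos x) _) (Real.rpow_pos_of_pos (hp₀pos x) _)
  have hi : Integrable (fun x => p₁ x ^ β * p₀ x ^ (1 - β)) μ := by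
    simpa using integrable_path_mul (g := fun _ => 1) hp₀ hp₁ hp₀pos hp₁pos measurable_const
      (by simpa using hint) hβ
  rw [pathZ, integral_pos_iff_support_of_nonneg (fun x => (hpos x).le) hi,
    Function.support_eq_univ (fun x => (hpos x).ne')]
  exact Measure.measure_univ_pos.2 hμ

theorem measurable_uncurry_pathDensity [SFinite μ] (hp₀ : Measurable p₀) (hp₁ : Measurable p₁) :
    Measurable (Function.uncurry fun (β : ℝ) x =>
      ENNReal.ofReal (p₁ x ^ β * p₀ x ^ (1 - β) / pathZ μ p₀ p₁ β)) := by
  have h : Measurable fun q : ℝ × 𝒳 => p₁ q.2 ^ q.1 * p₀ q.2 ^ (1 - q.1) := by fun_prop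
  have hZ : Measurable (pathZ μ p₀ p₁) := h.stronglyMeasurable.integral_prod_right.measurable
  exact (h.div (hZ.comp measurable_fst)).ennreal_ofReal

/-- Expectations under the thermodynamic-integration law are averages over `β` of expectations
under `P_β`. -/
theorem integrable_tiLaw_and_integral_eq [SFinite μ] (hp₀ : Measurable p₀) (hp₁ : Measurable p₁)
    (hp₀pos : ∀ x, 0 < p₀ x) (hp₁pos : ∀ x, 0 < p₁ x)
    (hint : Integrable (fun x => p₀ x + p₁ x) μ) (hμ : μ ≠ 0) (hg : Measurable g)
    (hgint : Integrable (fun x => (p₀ x + p₁ x) * |g x|) μ) :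
    Integrable g (tiLaw μ p₀ p₁) ∧
      ∫ x, g x ∂(tiLaw μ p₀ p₁) = ∫ β in (0 : ℝ)..1,
        (∫ x, p₁ x ^ β * p₀ x ^ (1 - β) * g x ∂μ) / pathZ μ p₀ p₁ β := by
  set f : ℝ → 𝒳 → ℝ≥0∞ := fun β x =>
    ENNReal.ofReal (p₁ x ^ β * p₀ x ^ (1 - β) / pathZ μ p₀ p₁ β)
  have hfm : Measurable (Function.uncurry f) := measurable_uncurry_pathDensity hp₀ hp₁
  set κ : Kernel ℝ 𝒳 := Kernel.withDensity (Kernel.const ℝ μ) f with hκ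
  have : IsSFiniteKernel κ := Kernel.IsSFiniteKernel.withDensity _ fun _ _ => ENNReal.ofReal_ne_top
  have hκf : ∀ β, κ β = μ.withDensity (f β) := fun β => by
    rw [hκ, Kernel.withDensity_apply _ hfm, Kernel.const_apply]
  have hlaw : tiLaw μ p₀ p₁ = κ ∘ₘ ((volume : Measure ℝ).restrict (Set.Icc 0 1)) := by
    rw [tiLaw]
    congr 1
    exact funext fun β => (hκf β).symm
  have hZ : ∀ β ∈ Set.Icc (0 : ℝ) 1, 0 < pathZ μ p₀ p₁ β := fun β hβ =>
    pathZ_pos hp₀ hp₁ hp₀pos hp₁pos hint hμ hβ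
  have hZcont : ContinuousOn (pathZ μ p₀ p₁) (Set.Icc 0 1) := by
    have hZdef : pathZ μ p₀ p₁ = fun β => ∫ x, p₁ x ^ β * p₀ x ^ (1 - β) ∂μ := rfl
    simpa [hZdef] using continuousOn_integral_path_mul (g := fun _ => 1) hp₀ hp₁ hp₀pos hp₁pos
      measurable_const (by simpa using hint)
  have hreal : ∀ β ∈ Set.Icc (0 : ℝ) 1, ∀ x,
      (f β x).toReal = p₁ x ^ β * p₀ x ^ (1 - β) / pathZ μ p₀ p₁ β := fun β hβ x =>
    ENNReal.toReal_ofReal (div_nonneg (mul_nonneg (Real.rpow_nonneg (hp₁pos x).le _)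
      (Real.rpow_nonneg (hp₀pos x).le _)) (hZ β hβ).le)
  have hκint : ∀ β ∈ Set.Icc (0 : ℝ) 1, ∀ h : 𝒳 → ℝ, ∫ x, h x ∂κ β =
      (∫ x, p₁ x ^ β * p₀ x ^ (1 - β) * h x ∂μ) / pathZ μ p₀ p₁ β := fun β hβ h => by
    rw [hκf, integral_withDensity_eq_integral_toReal_smul (hfm.of_uncurry_left)
      (.of_forall fun _ => ENNReal.ofReal_lt_top), ← integral_div]
    refine integral_congr_ae (.of_forall fun x => ?_)
    simp only [hreal β hβ, smul_eq_mul]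
    ring
  have hi : Integrable g (κ ∘ₘ ((volume : Measure ℝ).restrict (Set.Icc 0 1))) := by
    rw [Measure.integrable_comp_iff hg.aestronglyMeasurable]
    constructor
    · refine (ae_restrict_iff' measurableSet_Icc).2 (.of_forall fun β hβ => ?_)
      rw [hκf, integrable_withDensity_iff_integrable_smul' (hfm.of_uncurry_left)
        (.of_forall fun _ => ENNReal.ofReal_lt_top)]
      refine ((integrable_path_mul hp₀ hp₁ hp₀pos hp₁pos hg hgint hβ).div_const
        (pathZ μ p₀ p₁ β)).congr (.of_forall fun x => ?_)
      simp only [hreal β hβ, smul_eq_mul]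
      ring
    · have hc := (continuousOn_integral_path_mul (g := fun x => |g x|) hp₀ hp₁ hp₀pos hp₁pos
        (by fun_prop) (by simpa using hgint)).div hZcont fun β hβ => (hZ β hβ).ne'
      refine (hc.integrableOn_Icc (μ := volume)).congr_fun (fun β hβ => ?_) measurableSet_Icc
      exact (hκint β hβ _).symm
  rw [hlaw]
  refine ⟨hi, ?_⟩
  rw [Measure.comp_eq_comp_const_apply] at hi ⊢
  rw [Kernel.integral_comp hi, Kernel.const_apply, intervalIntegral.integral_of_le zero_le_one,
    ← integral_Icc_eq_integral_Ioc]
  exact setIntegral_congr_fun measurableSet_Icc fun β hβ => hκint β hβ g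

theorem integrable_add_mul_abs_log_pow (hp₀ : Measurable p₀) (hp₁ : Measurable p₁)
    (hp₀pos : ∀ x, 0 < p₀ x) (hp₁pos : ∀ x, 0 < p₁ x)
    (hdom : Integrable (fun x => (p₀ x + p₁ x) * (1 + Real.log (p₁ x / p₀ x) ^ 2)) μ)
    {k : ℕ} (hk : k ≤ 2) :
    Integrable (fun x => (p₀ x + p₁ x) * |Real.log (p₁ x / p₀ x) ^ k|) μ := by
  refine hdom.mono' (by fun_prop) (.of_forall fun x => ?_)
  have hp : 0 < p₀ x + p₁ x := add_pos (hp₀pos x) (hp₁pos x)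
  rw [Real.norm_of_nonneg (by positivity)]
  gcongr
  generalize Real.log (p₁ x / p₀ x) = u
  rw [abs_pow, ← sq_abs u]
  have := abs_nonneg u
  interval_cases k <;> nlinarith [sq_nonneg (|u| - 1)]

end GeometricPath

/-- **Law of total variance for the thermodynamic integration estimator.**
For the estimator `U′(X)` obtained by drawing `β ∼ Uniform([0,1])` and `X ∼ P_β`,
`Var[U′(X)] = ∫₀¹ v(β) dβ + ∫₀¹ m(β)² dβ - (∫₀¹ m(β) dβ)²`, and this is bounded by
`D₁ + D₀ + 2|log (Z₁/Z₀)| + ∫₀¹ m(β)² dβ - log² (Z₁/Z₀)`. -/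
theorem ti_variance_total_variance_bound
    {𝒳 : Type*} [MeasurableSpace 𝒳] (μ : Measure 𝒳) [SigmaFinite μ]
    (p₀ p₁ : 𝒳 → ℝ) (hp₀ : Measurable p₀) (hp₁ : Measurable p₁)
    (hp₀pos : ∀ x, 0 < p₀ x) (hp₁pos : ∀ x, 0 < p₁ x)
    (hint₀ : Integrable p₀ μ) (hint₁ : Integrable p₁ μ)
    (Z₀ Z₁ : ℝ) (hZ₀ : Z₀ = ∫ x, p₀ x ∂μ) (hZ₁ : Z₁ = ∫ x, p₁ x ∂μ)
    (hZ₀pos : 0 < Z₀) (hZ₁pos : 0 < Z₁)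
    (hdom : Integrable (fun x => (p₀ x + p₁ x) * (1 + Real.log (p₁ x / p₀ x) ^ 2)) μ)
    -- finiteness of the two Kullback–Leibler divergences
    (D₁ D₀ : ℝ)
    (hD₁ : D₁ = ∫ x, (p₁ x / Z₁) * Real.log ((p₁ x / Z₁) / (p₀ x / Z₀)) ∂μ)
    (hD₁int : Integrable (fun x => (p₁ x / Z₁) * Real.log ((p₁ x / Z₁) / (p₀ x / Z₀))) μ)
    (hD₀ : D₀ = ∫ x, (p₀ x / Z₀) * Real.log ((p₀ x / Z₀) / (p₁ x / Z₁)) ∂μ)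
    (hD₀int : Integrable (fun x => (p₀ x / Z₀) * Real.log ((p₀ x / Z₀) / (p₁ x / Z₁))) μ) :
    variance (fun x => Real.log (p₁ x / p₀ x)) (tiLaw μ p₀ p₁)
      = (∫ β in (0 : ℝ)..1, pathVar μ p₀ p₁ β)
        + (∫ β in (0 : ℝ)..1, pathMean μ p₀ p₁ β ^ 2)
        - (∫ β in (0 : ℝ)..1, pathMean μ p₀ p₁ β) ^ 2 ∧
    variance (fun x => Real.log (p₁ x / p₀ x)) (tiLaw μ p₀ p₁)
      ≤ D₁ + D₀ + 2 * |Real.log (Z₁ / Z₀)|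
        + (∫ β in (0 : ℝ)..1, pathMean μ p₀ p₁ β ^ 2)
        - Real.log (Z₁ / Z₀) ^ 2 := by
  have hμ : μ ≠ 0 := by
    rintro rfl
    simp [hZ₀] at hZ₀pos
  have hint : Integrable (fun x => p₀ x + p₁ x) μ := hint₀.add hint₁
  have hU : Measurable fun x => Real.log (p₁ x / p₀ x) := (hp₁.div hp₀).log
  have hbd : ∀ k ≤ 2, Integrable (fun x => (p₀ x + p₁ x) * |Real.log (p₁ x / p₀ x) ^ k|) μ :=
    fun k hk => integrable_add_mul_abs_log_pow hp₀ hp₁ hp₀pos hp₁pos hdom hk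
  set M : ℕ → ℝ → ℝ := fun k β =>
    ∫ x, p₁ x ^ β * p₀ x ^ (1 - β) * Real.log (p₁ x / p₀ x) ^ k ∂μ with hM
  have hMcont : ∀ k ≤ 2, ContinuousOn (M k) (Set.Icc 0 1) := fun k hk =>
    continuousOn_integral_path_mul hp₀ hp₁ hp₀pos hp₁pos (hU.pow_const k) (hbd k hk)
  have hMderiv : ∀ k ≤ 1, ∀ β ∈ Set.Ioo (0 : ℝ) 1, HasDerivAt (M k) (M (k + 1) β) β := by
    intro k hk β hβ
    have h := hasDerivAt_integral_path_mul hp₀ hp₁ hp₀pos hp₁pos (hU.pow_const k)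
      (hbd k (by lia)) (by simpa only [← pow_succ'] using hbd (k + 1) (by lia)) hβ
    simpa only [← pow_succ'] using h
  have hZM : ∀ β, pathZ μ p₀ p₁ β = M 0 β := fun β => by simp [pathZ, hM]
  have hM0 : ∀ β ∈ Set.Icc (0 : ℝ) 1, 0 < M 0 β := fun β hβ =>
    hZM β ▸ pathZ_pos hp₀ hp₁ hp₀pos hp₁pos hint hμ hβ
  have hdiv : ∀ k β, ∫ x, (p₁ x ^ β * p₀ x ^ (1 - β) / pathZ μ p₀ p₁ β) *
      Real.log (p₁ x / p₀ x) ^ k ∂μ = M k β / M 0 β := fun k β => by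
    rw [hZM, hM, ← integral_div]
    exact integral_congr_ae (.of_forall fun x => by ring)
  have hmean : pathMean μ p₀ p₁ = fun β => M 1 β / M 0 β :=
    funext fun β => by simpa only [pow_one, pathMean] using hdiv 1 β
  have hvar : pathVar μ p₀ p₁ = fun β => M 2 β / M 0 β - pathMean μ p₀ p₁ β ^ 2 :=
    funext fun β => by rw [pathVar, hdiv 2 β]
  have hquot : ∀ k ≤ 2, ContinuousOn (fun β => M k β / M 0 β) (Set.Icc 0 1) := fun k hk =>
    (hMcont k hk).div (hMcont 0 (by lia)) fun β hβ => (hM0 β hβ).ne'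
  have hmeanc : ContinuousOn (pathMean μ p₀ p₁) (Set.Icc 0 1) := hmean ▸ hquot 1 (by lia)
  have hvarc : ContinuousOn (pathVar μ p₀ p₁) (Set.Icc 0 1) :=
    hvar ▸ (hquot 2 le_rfl).sub (hmeanc.pow 2)
  have hII : ∀ f : ℝ → ℝ, ContinuousOn f (Set.Icc 0 1) → IntervalIntegrable f volume 0 1 :=
    fun f hf => hf.intervalIntegrable_of_Icc zero_le_one
  -- the law of total variance
  have hti : ∀ k ≤ 2, Integrable (fun x => Real.log (p₁ x / p₀ x) ^ k) (tiLaw μ p₀ p₁) ∧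
      ∫ x, Real.log (p₁ x / p₀ x) ^ k ∂(tiLaw μ p₀ p₁) = ∫ β in (0 : ℝ)..1, M k β / M 0 β := by
    intro k hk
    simpa only [hZM] using integrable_tiLaw_and_integral_eq hp₀ hp₁ hp₀pos hp₁pos hint hμ
      (hU.pow_const k) (hbd k hk)
  have hprob : IsProbabilityMeasure (tiLaw μ p₀ p₁) := by
    have h1 : ∫ β in (0 : ℝ)..1, M 0 β / M 0 β = 1 := by
      rw [intervalIntegral.integral_congr (g := fun _ => (1 : ℝ))]
      · simp
      · intro β hβ
        rw [Set.uIcc_of_le zero_le_one] at hβ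
        exact div_self (hM0 β hβ).ne'
    have h0 := (hti 0 (by lia)).2
    simp only [pow_zero, integral_const, smul_eq_mul, mul_one] at h0
    rw [h1, measureReal_def, ENNReal.toReal_eq_one_iff] at h0
    exact ⟨h0⟩
  have hMem : MemLp (fun x => Real.log (p₁ x / p₀ x)) 2 (tiLaw μ p₀ p₁) :=
    (memLp_two_iff_integrable_sq hU.aestronglyMeasurable).2 (hti 2 le_rfl).1
  have htotal : variance (fun x => Real.log (p₁ x / p₀ x)) (tiLaw μ p₀ p₁)
      = (∫ β in (0 : ℝ)..1, pathVar μ p₀ p₁ β)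
        + (∫ β in (0 : ℝ)..1, pathMean μ p₀ p₁ β ^ 2)
        - (∫ β in (0 : ℝ)..1, pathMean μ p₀ p₁ β) ^ 2 := by
    have h1 := (hti 1 (by lia)).2
    simp only [pow_one] at h1
    have h2 := intervalIntegral.integral_add (hII _ hvarc)
      (hII (fun β => pathMean μ p₀ p₁ β ^ 2) (hmeanc.pow 2))
    rw [variance_eq_sub hMem, h1, ← h2]
    simp only [Pi.pow_apply, (hti 2 le_rfl).2, hvar, hmean, sub_add_cancel]
  -- thermodynamic integration: `log Z` is a primitive of the mean, the mean one of the variance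
  have hM00 : M 0 0 = Z₀ := by simp [hM, hZ₀]
  have hM01 : M 0 1 = Z₁ := by simp [hM, hZ₁]
  have hImean : ∫ β in (0 : ℝ)..1, pathMean μ p₀ p₁ β = Real.log (Z₁ / Z₀) := by
    rw [intervalIntegral.integral_eq_sub_of_hasDerivAt_of_le (f := fun β => Real.log (M 0 β))
      zero_le_one ((hMcont 0 (by lia)).log fun β hβ => (hM0 β hβ).ne') (fun β hβ => ?_)
      (hII _ hmeanc), hM00, hM01, Real.log_div hZ₁pos.ne' hZ₀pos.ne']
    rw [hmean]
    exact (hMderiv 0 (by lia) β hβ).log (hM0 β (Set.Ioo_subset_Icc_self hβ)).ne'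
  have hIvar : ∫ β in (0 : ℝ)..1, pathVar μ p₀ p₁ β = pathMean μ p₀ p₁ 1 - pathMean μ p₀ p₁ 0 := by
    refine intervalIntegral.integral_eq_sub_of_hasDerivAt_of_le zero_le_one hmeanc (fun β hβ => ?_)
      (hII _ hvarc)
    have h0 := (hM0 β (Set.Ioo_subset_Icc_self hβ)).ne'
    simp only [hvar, hmean]
    refine ((hMderiv 1 le_rfl β hβ).div (hMderiv 0 (by lia) β hβ) h0).congr_deriv ?_
    field_simp
  -- the endpoint means differ by the symmetrised divergence
  have hlog : ∀ x, Real.log ((p₁ x / Z₁) / (p₀ x / Z₀))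
      = Real.log (p₁ x / p₀ x) - Real.log (Z₁ / Z₀) := fun x => by
    rw [← Real.log_div (div_pos (hp₁pos x) (hp₀pos x)).ne' (div_pos hZ₁pos hZ₀pos).ne']
    congr 1
    have := (hp₀pos x).ne'
    field_simp
  have hlog' : ∀ x, Real.log ((p₀ x / Z₀) / (p₁ x / Z₁))
      = Real.log (Z₁ / Z₀) - Real.log (p₁ x / p₀ x) := fun x => by
    rw [← inv_div, Real.log_inv, hlog, neg_sub]
  have hi1 : Integrable (fun x => p₁ x * Real.log (p₁ x / p₀ x)) μ := by
    simpa using integrable_path_mul hp₀ hp₁ hp₀pos hp₁pos (hU.pow_const 1) (hbd 1 (by lia))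
      (Set.right_mem_Icc.2 zero_le_one)
  have hi0 : Integrable (fun x => p₀ x * Real.log (p₁ x / p₀ x)) μ := by
    simpa using integrable_path_mul hp₀ hp₁ hp₀pos hp₁pos (hU.pow_const 1) (hbd 1 (by lia))
      (Set.left_mem_Icc.2 zero_le_one)
  have hM11 : M 1 1 = ∫ x, p₁ x * Real.log (p₁ x / p₀ x) ∂μ := by simp [hM]
  have hM10 : M 1 0 = ∫ x, p₀ x * Real.log (p₁ x / p₀ x) ∂μ := by simp [hM]
  have hD1 : D₁ = pathMean μ p₀ p₁ 1 - Real.log (Z₁ / Z₀) := by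
    have : ∀ x, p₁ x / Z₁ * (Real.log (p₁ x / p₀ x) - Real.log (Z₁ / Z₀)) =
        (p₁ x * Real.log (p₁ x / p₀ x)) / Z₁ - p₁ x * (Real.log (Z₁ / Z₀) / Z₁) :=
      fun x => by ring
    simp only [hD₁, hlog, this, hmean]
    rw [integral_sub (hi1.div_const _) (hint₁.mul_const _), integral_div, integral_mul_const,
      ← hZ₁, hM11, hM01, mul_div_cancel₀ _ hZ₁pos.ne']
  have hD0 : D₀ = Real.log (Z₁ / Z₀) - pathMean μ p₀ p₁ 0 := by
    have : ∀ x, p₀ x / Z₀ * (Real.log (Z₁ / Z₀) - Real.log (p₁ x / p₀ x)) =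
        p₀ x * (Real.log (Z₁ / Z₀) / Z₀) - (p₀ x * Real.log (p₁ x / p₀ x)) / Z₀ :=
      fun x => by ring
    simp only [hD₀, hlog', this, hmean]
    rw [integral_sub (hint₀.mul_const _) (hi0.div_const _), integral_div, integral_mul_const,
      ← hZ₀, hM10, hM00, mul_div_cancel₀ _ hZ₀pos.ne']
  refine ⟨htotal, ?_⟩
  rw [htotal, hImean, hIvar, hD1, hD0]
  linarith [abs_nonneg (Real.log (Z₁ / Z₀))]
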